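/- arXiv:1707.09542 — 2 statements merged into one kernel-verified Lean document; each statement's English description precedes it below -/
import Mathlib

section
/- Let K be a field, N ≥ 1 an integer, and h ∈ K. For every u ∈ K with u ≠ 0, u² ≠ h² and u + hN ≠ 0, the Yang R-matrix satisfies the (unnormalized) crossing symmetry relation in the second tensor factor: (R(u)⁻¹)^{t₂} · (R(u + hN))^{t₂} = (1 − h²u⁻²)⁻¹ · id on K^N ⊗ K^N. -/
/-- The permutation operator `P` on `K^N ⊗ K^N`, `P(x ⊗ y) = y ⊗ x`,
written as a matrix with rows/columns indexed by `Fin N × Fin N`. -/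
def permP (K : Type*) [Field K] (N : ℕ) : Matrix (Fin N × Fin N) (Fin N × Fin N) K :=
  fun p q => if p.1 = q.2 ∧ p.2 = q.1 then 1 else 0

/-- The Yang R-matrix `R(z) = id - (h/z) • P` on `K^N ⊗ K^N`. -/
def yangR (K : Type*) [Field K] (N : ℕ) (h z : K) :
    Matrix (Fin N × Fin N) (Fin N × Fin N) K :=
  1 - (h / z) • permP K N

/-- The partial transpose `t₂` on `End(K^N) ⊗ End(K^N)`, determined by
`(A ⊗ B)^{t₂} = A ⊗ Bᵀ`. -/
def pt2 {K : Type*} [Field K] {N : ℕ}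
    (M : Matrix (Fin N × Fin N) (Fin N × Fin N) K) :
    Matrix (Fin N × Fin N) (Fin N × Fin N) K :=
  fun p q => M (p.1, q.2) (q.1, p.2)

theorem permP_mul_permP (K : Type*) [Field K] (N : ℕ) : permP K N * permP K N = 1 := by
  ext ⟨a, b⟩ ⟨c, d⟩
  simp only [Matrix.mul_apply, permP, Fintype.sum_prod_type, Matrix.one_apply, Prod.mk.injEq,
    ← ite_and, mul_ite, mul_one, mul_zero]
  rw [Finset.sum_eq_single b (fun x _ hx => Finset.sum_eq_zero fun y _ => by grind) (by simp),
    Finset.sum_eq_single a (fun y _ hy => by grind) (by simp)]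
  grind

theorem yangR_mul_yangR_neg (K : Type*) [Field K] (N : ℕ) (h z : K) :
    yangR K N h z * yangR K N h (-z) = (1 - h ^ 2 / z ^ 2) • 1 := by
  simp only [← div_pow, yangR, div_neg, neg_smul, sub_neg_eq_add, sub_mul, mul_add, one_mul,
    mul_one, smul_mul_assoc, mul_smul_comm, permP_mul_permP]
  module

theorem yangR_inv (K : Type*) [Field K] (N : ℕ) {h z : K} (hz : 1 - h ^ 2 / z ^ 2 ≠ 0) :
    (yangR K N h z)⁻¹ = (1 - h ^ 2 / z ^ 2)⁻¹ • yangR K N h (-z) := by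
  apply Matrix.inv_eq_right_inv
  rw [mul_smul_comm, yangR_mul_yangR_neg, smul_smul, inv_mul_cancel₀ hz, one_smul]

theorem pt2_smul {K : Type*} [Field K] {N : ℕ} (c : K)
    (M : Matrix (Fin N × Fin N) (Fin N × Fin N) K) : pt2 (c • M) = c • pt2 M := rfl

theorem pt2_sub {K : Type*} [Field K] {N : ℕ}
    (A B : Matrix (Fin N × Fin N) (Fin N × Fin N) K) : pt2 (A - B) = pt2 A - pt2 B := rfl

theorem pt2_one (K : Type*) [Field K] (N : ℕ) :
    pt2 (1 : Matrix (Fin N × Fin N) (Fin N × Fin N) K) = 1 := by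
  ext ⟨a, b⟩ ⟨c, d⟩
  simp [pt2, Matrix.one_apply, eq_comm]

theorem pt2_yangR (K : Type*) [Field K] (N : ℕ) (h z : K) :
    pt2 (yangR K N h z) = 1 - (h / z) • pt2 (permP K N) := by
  rw [yangR, pt2_sub, pt2_smul, pt2_one]

theorem pt2_permP_mul_pt2_permP (K : Type*) [Field K] (N : ℕ) :
    pt2 (permP K N) * pt2 (permP K N) = (N : K) • pt2 (permP K N) := by
  ext ⟨a, b⟩ ⟨c, d⟩
  by_cases hab : a = b <;> by_cases hcd : d = c <;>
    simp [Matrix.mul_apply, pt2, permP, Fintype.sum_prod_type, hab, hcd]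

/-- Unnormalized crossing symmetry of the Yang R-matrix in the second factor:
`(R(u)⁻¹)^{t₂} · (R(u + hN))^{t₂} = (1 − h²u⁻²)⁻¹ · id`. -/
theorem yangR_crossing_t2 (K : Type*) [Field K] (N : ℕ) (hN : 1 ≤ N)
    (h u : K) (hu : u ≠ 0) (hu2 : u ^ 2 ≠ h ^ 2) (huN : u + h * N ≠ 0) :
    pt2 ((yangR K N h u)⁻¹) * pt2 (yangR K N h (u + h * N)) =
      (1 - h ^ 2 / u ^ 2)⁻¹ • (1 : Matrix (Fin N × Fin N) (Fin N × Fin N) K) := by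
  have hz : 1 - h ^ 2 / u ^ 2 ≠ 0 := by
    rw [sub_ne_zero, ne_comm, Ne, div_eq_one_iff_eq (pow_ne_zero 2 hu)]
    exact hu2.symm
  have hc : h / u - h / (u + h * N) - h / u * (h / (u + h * N)) * N = 0 := by
    field_simp
    ring
  rw [yangR_inv K N hz, pt2_smul, smul_mul_assoc, pt2_yangR, pt2_yangR]
  congr 1
  calc _ = 1 + (h / u - h / (u + h * N) - h / u * (h / (u + h * N)) * N) • pt2 (permP K N) := by
        simp only [div_neg, neg_smul, sub_neg_eq_add, add_mul, mul_sub, one_mul, mul_one,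
          smul_mul_assoc, mul_smul_comm, pt2_permP_mul_pt2_permP, smul_smul, sub_smul]
        module
    _ = 1 := by rw [hc, zero_smul, add_zero]
end

section
/- Let n ≥ 1 be an integer. In the group algebra ℚ[𝔖_n] of the symmetric group, the ordered product over all pairs (i,j) with 1 ≤ i < j ≤ n, taken in lexicographic order (i.e., the nested product ∏_{i=1}^{n-1} ∏_{j=i+1}^{n}, factors multiplied left to right), satisfies: ∏_{1 ≤ i < j ≤ n} ( 1 + (i j)/(j−i) ) = Σ_{s ∈ 𝔖_n} s, where (i j) denotes the transposition of i and j. (This is the fusion procedure evaluated at the contents of the row diagram with n boxes: the hook product is n! and the resulting idempotent is the symmetrizer h^{(n)} = (1/n!) Σ_s s.) -/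
/-- The list of pairs `(i,j)` with `i < j`, in lexicographic order. -/
def lexPairs (n : ℕ) : List (Fin n × Fin n) :=
  (List.finRange n).flatMap fun i =>
    ((List.finRange n).filter fun j => i < j).map fun j => (i, j)

theorem lexPairs_succ (n : ℕ) :
    lexPairs (n + 1) = ((List.finRange n).map fun j => ((0 : Fin (n + 1)), j.succ)) ++
      (lexPairs n).map (Prod.map Fin.succ Fin.succ) := by
  simp [lexPairs, List.finRange_succ, List.filter_map, List.flatMap_map, List.map_flatMap,
    Function.comp_def]

section Telescoping

variable {A : Type*} [Ring A] [Algebra ℚ A]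

theorem prod_one_add_inv_smul_mul_of_fixed {n : ℕ} (a : Fin n → A) (x : A)
    (h : ∀ j, a j * x = x) :
    ((List.finRange n).map fun j => 1 + ((j.val : ℚ) + 1)⁻¹ • a j).prod * x =
      ((n : ℚ) + 1) • x := by
  induction n with
  | zero => simp
  | succ n ih =>
    have hn : (n : ℚ) + 1 ≠ 0 := by positivity
    have ih' := ih (fun j => a j.castSucc) fun j => h _
    simp only [List.finRange_succ_last, List.map_append, List.map_map, List.prod_append,
      Function.comp_def, List.map_cons, List.map_nil, List.prod_singleton, Fin.val_castSucc,
      Fin.val_last, mul_assoc, add_mul, one_mul, smul_mul_assoc, h, mul_add, mul_smul_comm, ih',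
      smul_smul, ← add_smul]
    congr 1
    push_cast
    field_simp

theorem prod_one_add_inv_smul_mul {n : ℕ} (a : Fin n → A) (x : A)
    (h : ∀ j k, j < k → a j * (a k * x) = a k * x) :
    ((List.finRange n).map fun j => 1 + ((j.val : ℚ) + 1)⁻¹ • a j).prod * x =
      x + ∑ k, a k * x := by
  induction n with
  | zero => simp
  | succ n ih =>
    have hn : (n : ℚ) + 1 ≠ 0 := by positivity
    have ih' := ih (fun j => a j.castSucc) fun j k hjk => h _ _ (by simpa using hjk)
    have hlast := prod_one_add_inv_smul_mul_of_fixed (fun j : Fin n => a j.castSucc)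
      (a (Fin.last n) * x) fun j => h _ _ (Fin.castSucc_lt_last j)
    simp only [List.finRange_succ_last, List.map_append, List.map_map, List.prod_append,
      Function.comp_def, List.map_cons, List.map_nil, List.prod_singleton, Fin.val_castSucc,
      Fin.val_last, mul_assoc, add_mul, one_mul, smul_mul_assoc, mul_add, mul_smul_comm, ih',
      hlast, smul_smul, inv_mul_cancel₀ hn, one_smul, Fin.sum_univ_castSucc, add_assoc]

end Telescoping

/-- The embedding of `Perm (Fin n)` into `Perm (Fin (n + 1))` as the stabilizer of `0`. -/
def permSucc (n : ℕ) : Equiv.Perm (Fin n) →* Equiv.Perm (Fin (n + 1)) :=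
  MonoidHom.mk' (fun e => Equiv.Perm.decomposeFin.symm (0, e)) fun e f => by
    ext i
    cases i using Fin.cases <;> simp

theorem permSucc_swap {n : ℕ} (i j : Fin n) :
    permSucc n (Equiv.swap i j) = Equiv.swap i.succ j.succ := by
  ext k
  cases k using Fin.cases with
  | zero =>
    rw [Equiv.swap_apply_of_ne_of_ne (Fin.succ_ne_zero i).symm (Fin.succ_ne_zero j).symm]
    simp [permSucc]
  | succ k =>
    rw [(Fin.succ_injective n).swap_apply]
    simp [permSucc]

theorem swap_mul_permSucc {n : ℕ} (p : Fin (n + 1)) (e : Equiv.Perm (Fin n)) :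
    Equiv.swap 0 p * permSucc n e = Equiv.Perm.decomposeFin.symm (p, e) := by
  ext i
  cases i using Fin.cases <;> simp [permSucc]

theorem swap_zero_mul_swap_zero_mul_permSucc {n : ℕ} {j k : Fin n} (h : j ≠ k)
    (e : Equiv.Perm (Fin n)) :
    Equiv.swap 0 j.succ * (Equiv.swap 0 k.succ * permSucc n e) =
      Equiv.swap 0 k.succ * permSucc n (Equiv.swap j k * e) := by
  have hjk : j.succ ≠ k.succ := fun hs => h (Fin.succ_injective n hs)
  have hs := Equiv.mul_swap_eq_swap_mul (Equiv.swap 0 k.succ) j.succ k.succ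
  rw [Equiv.swap_apply_of_ne_of_ne (Fin.succ_ne_zero j) hjk, Equiv.swap_apply_right,
    Equiv.swap_comm j.succ 0] at hs
  rw [map_mul, permSucc_swap, ← mul_assoc, ← mul_assoc, hs]

theorem sum_perm_fin_succ (n : ℕ) :
    (∑ s : Equiv.Perm (Fin (n + 1)), MonoidAlgebra.of ℚ (Equiv.Perm (Fin (n + 1))) s) =
      (∑ e, MonoidAlgebra.of ℚ _ (permSucc n e)) +
        ∑ k : Fin n, MonoidAlgebra.of ℚ _ (Equiv.swap 0 k.succ) *
          ∑ e, MonoidAlgebra.of ℚ _ (permSucc n e) := by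
  rw [← Equiv.Perm.decomposeFin.symm.sum_comp, Fintype.sum_prod_type, Fin.sum_univ_succ]
  simp only [Finset.mul_sum, ← map_mul, swap_mul_permSucc]
  rfl

theorem fusion_row_symmetrizer (n : ℕ) (hn : 1 ≤ n) :
    ((lexPairs n).map fun p =>
        (1 : MonoidAlgebra ℚ (Equiv.Perm (Fin n))) +
          ((p.2.val : ℚ) - (p.1.val : ℚ))⁻¹ •
            MonoidAlgebra.of ℚ (Equiv.Perm (Fin n)) (Equiv.swap p.1 p.2)).prod =
      ∑ s : Equiv.Perm (Fin n), MonoidAlgebra.of ℚ (Equiv.Perm (Fin n)) s := by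
  clear hn
  induction n with
  | zero => simp [lexPairs, MonoidAlgebra.one_def]
  | succ n ih =>
    have ih' := congrArg (MonoidAlgebra.mapDomainAlgHom ℚ ℚ (permSucc n)) ih
    rw [map_list_prod, List.map_map, map_sum] at ih'
    simp only [Function.comp_def, map_add, map_one, map_smul, MonoidAlgebra.of_apply,
      MonoidAlgebra.mapDomainAlgHom_apply, MonoidAlgebra.mapDomain_single, permSucc_swap] at ih'
    have hrow := prod_one_add_inv_smul_mul
      (fun j : Fin n => MonoidAlgebra.of ℚ _ (Equiv.swap 0 j.succ))
      (∑ e, MonoidAlgebra.of ℚ _ (permSucc n e)) fun j k hjk => by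
        simp only [Finset.mul_sum, ← map_mul,
          swap_zero_mul_swap_zero_mul_permSucc hjk.ne]
        exact Equiv.sum_comp (Equiv.mulLeft (Equiv.swap j k)) fun e =>
          MonoidAlgebra.of ℚ _ (Equiv.swap 0 k.succ * permSucc n e)
    rw [sum_perm_fin_succ, ← hrow, lexPairs_succ, List.map_append, List.prod_append,
      List.map_map, List.map_map]
    simp only [Function.comp_def, Prod.map_fst, Prod.map_snd, Fin.val_succ, Fin.val_zero,
      Nat.cast_add, Nat.cast_one, Nat.cast_zero, sub_zero, add_sub_add_right_eq_sub,
      MonoidAlgebra.of_apply, ih']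
end
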